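/- Let ℓ ∈ ℝ∖{0}, c ∈ ℝ, let φ : ℝ → ℂ be a Schwartz function, and write Θ(x,y,r) = Θ_{ℓ,c}(φ)(x+iy, r). Then for all (x,y,r) ∈ ℝ³: (∂Θ/∂x)(x,y,r) − y·(∂Θ/∂r)(x,y,r) = −4πiℓ · Θ_{ℓ,c}(φ₁)(x+iy, r), where φ₁(ξ) = ξ·φ(ξ); (∂Θ/∂y)(x,y,r) + x·(∂Θ/∂r)(x,y,r) = Θ_{ℓ,c}(φ′)(x+iy, r), where φ′ is the derivative of φ; and (∂Θ/∂r)(x,y,r) = 2πiℓ · Θ(x,y,r). -/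

import Mathlib

/-- The theta function `Θ_{ℓ,c}(φ)(n(x+iy,r))`, as a function of `(x,y,r) ∈ ℝ³`. -/
noncomputable def thetaFun (ℓ c : ℝ) (φ : ℝ → ℂ) (x y r : ℝ) : ℂ :=
  ∑' k : ℤ,
    Complex.exp (((2 * Real.pi * ℓ * (r - x * (c / ℓ + 2 * (k : ℝ) + y)) : ℝ) : ℂ) *
        Complex.I) *
      φ (c / (2 * ℓ) + (k : ℝ) + y)

open Metric

theorem summable_inv_one_add_int_sq : Summable fun k : ℤ => (1 + (k : ℝ) ^ 2)⁻¹ := by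
  refine Summable.of_norm_bounded_eventually (Real.summable_one_div_int_pow.mpr one_lt_two) ?_
  filter_upwards [(Set.finite_singleton (0 : ℤ)).compl_mem_cofinite] with k hk
  have hk' : (k : ℝ) ≠ 0 := by exact_mod_cast hk
  rw [Real.norm_of_nonneg (by positivity), one_div]
  gcongr
  linarith

theorem SchwartzMap.exists_one_add_sq_mul_le (φ : SchwartzMap ℝ ℂ) (n : ℕ) :
    ∃ C, ∀ ξ : ℝ, (1 + ξ ^ 2) * (|ξ| ^ n * ‖φ ξ‖) ≤ C := by
  obtain ⟨C₁, -, h₁⟩ := φ.decay n 0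
  obtain ⟨C₂, -, h₂⟩ := φ.decay (n + 2) 0
  refine ⟨C₁ + C₂, fun ξ => ?_⟩
  have h₁ := h₁ ξ
  have h₂ := h₂ ξ
  simp only [norm_iteratedFDeriv_zero, Real.norm_eq_abs] at h₁ h₂
  rw [pow_add, sq_abs] at h₂
  linarith

/-- A function decaying like `(1 + ξ²)⁻¹` is bounded on translates of `ℤ` by a summable sequence,
locally uniformly in the translation. -/
theorem exists_summable_bound_int_translates {f : ℝ → ℂ} {C : ℝ}
    (hf : ∀ ξ : ℝ, (1 + ξ ^ 2) * ‖f ξ‖ ≤ C) (a y₀ : ℝ) :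
    ∃ u : ℤ → ℝ, Summable u ∧ ∀ (k : ℤ), ∀ y ∈ ball y₀ 1, ‖f (a + k + y)‖ ≤ u k := by
  set A := |a| + |y₀| + 1
  refine ⟨fun k => 2 * (1 + A ^ 2) * C * (1 + (k : ℝ) ^ 2)⁻¹,
    summable_inv_one_add_int_sq.mul_left _, fun k y hy => ?_⟩
  rw [mem_ball, Real.dist_eq] at hy
  have hay : |a + y| ≤ A := by
    have h₁ := abs_add_le a y
    have h₂ := abs_add_le (y - y₀) y₀
    rw [sub_add_cancel] at h₂
    linarith
  have hsq : (a + y) ^ 2 ≤ A ^ 2 := sq_le_sq' (by linarith [neg_abs_le (a + y)])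
    (by linarith [le_abs_self (a + y)])
  beta_reduce
  rw [← div_eq_mul_inv, le_div_iff₀ (by positivity)]
  set ξ := a + k + y with hξ
  have hk : (k : ℝ) = ξ - (a + y) := by rw [hξ]; ring
  have hle : 1 + (k : ℝ) ^ 2 ≤ 2 * (1 + A ^ 2) * (1 + ξ ^ 2) := by
    rw [hk]
    nlinarith [sq_nonneg (ξ + (a + y)), mul_nonneg (sq_nonneg A) (sq_nonneg ξ)]
  calc ‖f ξ‖ * (1 + (k : ℝ) ^ 2) ≤ ‖f ξ‖ * (2 * (1 + A ^ 2) * (1 + ξ ^ 2)) := by gcongr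
    _ = 2 * (1 + A ^ 2) * ((1 + ξ ^ 2) * ‖f ξ‖) := by ring
    _ ≤ 2 * (1 + A ^ 2) * C := by gcongr; exact hf ξ

/-- The summand of index `k` of `thetaFun`. -/
noncomputable def thetaTerm (ℓ c : ℝ) (φ : ℝ → ℂ) (k : ℤ) (x y r : ℝ) : ℂ :=
  Complex.exp (((2 * Real.pi * ℓ * (r - x * (c / ℓ + 2 * (k : ℝ) + y)) : ℝ) : ℂ) * Complex.I) *
    φ (c / (2 * ℓ) + (k : ℝ) + y)

theorem norm_thetaTerm (ℓ c : ℝ) (φ : ℝ → ℂ) (k : ℤ) (x y r : ℝ) :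
    ‖thetaTerm ℓ c φ k x y r‖ = ‖φ (c / (2 * ℓ) + k + y)‖ := by
  rw [thetaTerm, norm_mul, Complex.norm_exp_ofReal_mul_I, one_mul]

theorem exists_summable_bound_thetaTerm (ℓ c : ℝ) {f : ℝ → ℂ} {C : ℝ}
    (hf : ∀ ξ : ℝ, (1 + ξ ^ 2) * ‖f ξ‖ ≤ C) (y₀ : ℝ) :
    ∃ u : ℤ → ℝ, Summable u ∧
      ∀ (k : ℤ) (x r : ℝ), ∀ y ∈ ball y₀ 1, ‖thetaTerm ℓ c f k x y r‖ ≤ u k := by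
  obtain ⟨u, hu, h⟩ := exists_summable_bound_int_translates hf (c / (2 * ℓ)) y₀
  exact ⟨u, hu, fun k x r y hy => (norm_thetaTerm ℓ c f k x y r).trans_le (h k y hy)⟩

theorem hasDerivAt_exp_ofReal_mul_I {g : ℝ → ℝ} {g' t : ℝ} (hg : HasDerivAt g g' t) :
    HasDerivAt (fun s => Complex.exp ((g s : ℂ) * Complex.I))
      (Complex.exp ((g t : ℂ) * Complex.I) * (g' * Complex.I)) t :=
  (hg.ofReal_comp.mul_const Complex.I).cexp

theorem hasDerivAt_thetaTerm_r (ℓ c : ℝ) (φ : ℝ → ℂ) (k : ℤ) (x y r : ℝ) :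
    HasDerivAt (fun r' => thetaTerm ℓ c φ k x y r')
      (2 * (Real.pi : ℂ) * Complex.I * (ℓ : ℂ) * thetaTerm ℓ c φ k x y r) r := by
  have hg : HasDerivAt (fun r' => 2 * Real.pi * ℓ * (r' - x * (c / ℓ + 2 * (k : ℝ) + y)))
      (2 * Real.pi * ℓ * 1) r := ((hasDerivAt_id r).sub_const _).const_mul _
  refine ((hasDerivAt_exp_ofReal_mul_I hg).mul_const (φ (c / (2 * ℓ) + k + y))).congr_deriv ?_
  rw [thetaTerm]
  push_cast
  ring

theorem hasDerivAt_thetaTerm_x (ℓ c : ℝ) (φ : ℝ → ℂ) (k : ℤ) (x y r : ℝ) :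
    HasDerivAt (fun x' => thetaTerm ℓ c φ k x' y r)
      (-(4 * (Real.pi : ℂ) * Complex.I * (ℓ : ℂ)) *
          thetaTerm ℓ c (fun ξ => (ξ : ℂ) * φ ξ) k x y r +
        2 * (Real.pi : ℂ) * Complex.I * (ℓ : ℂ) * y * thetaTerm ℓ c φ k x y r) x := by
  have hg : HasDerivAt (fun x' => 2 * Real.pi * ℓ * (r - x' * (c / ℓ + 2 * (k : ℝ) + y)))
      (2 * Real.pi * ℓ * -(1 * (c / ℓ + 2 * (k : ℝ) + y))) x :=
    (((hasDerivAt_id x).mul_const _).const_sub _).const_mul _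
  refine ((hasDerivAt_exp_ofReal_mul_I hg).mul_const (φ (c / (2 * ℓ) + k + y))).congr_deriv ?_
  have hc : c / ℓ = 2 * (c / (2 * ℓ)) := by ring
  simp only [thetaTerm]
  rw [hc]
  push_cast
  ring

theorem hasDerivAt_thetaTerm_y (ℓ c : ℝ) {φ : ℝ → ℂ} (hφ : Differentiable ℝ φ) (k : ℤ)
    (x y r : ℝ) :
    HasDerivAt (fun y' => thetaTerm ℓ c φ k x y' r)
      (thetaTerm ℓ c (deriv φ) k x y r -
        2 * (Real.pi : ℂ) * Complex.I * (ℓ : ℂ) * x * thetaTerm ℓ c φ k x y r) y := by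
  have hg : HasDerivAt (fun y' => 2 * Real.pi * ℓ * (r - x * (c / ℓ + 2 * (k : ℝ) + y')))
      (2 * Real.pi * ℓ * -(x * 1)) y :=
    ((((hasDerivAt_id y).const_add _).const_mul _).const_sub _).const_mul _
  have hd : HasDerivAt (fun y' => φ (c / (2 * ℓ) + k + y')) (deriv φ (c / (2 * ℓ) + k + y)) y :=
    (hφ _).hasDerivAt.comp_const_add _ _
  refine ((hasDerivAt_exp_ofReal_mul_I hg).mul hd).congr_deriv ?_
  simp only [thetaTerm]
  push_cast
  ring

/-- Differentiation rules for theta functions: with `Θ = Θ_{ℓ,c}(φ)`,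
`(∂_x − y∂_r)Θ = −4πiℓ·Θ_{ℓ,c}(ξφ(ξ))`, `(∂_y + x∂_r)Θ = Θ_{ℓ,c}(φ′)`, and
`∂_r Θ = 2πiℓ·Θ`. -/
theorem stmt_7 (ℓ : ℝ) (hℓ : ℓ ≠ 0) (c : ℝ) (φ : SchwartzMap ℝ ℂ) (x y r : ℝ) :
    deriv (fun x' => thetaFun ℓ c (⇑φ) x' y r) x
        - (y : ℂ) * deriv (fun r' => thetaFun ℓ c (⇑φ) x y r') r
      = -(4 * (Real.pi : ℂ) * Complex.I * (ℓ : ℂ)) *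
          thetaFun ℓ c (fun ξ => (ξ : ℂ) * φ ξ) x y r ∧
    deriv (fun y' => thetaFun ℓ c (⇑φ) x y' r) y
        + (x : ℂ) * deriv (fun r' => thetaFun ℓ c (⇑φ) x y r') r
      = thetaFun ℓ c (deriv (⇑φ)) x y r ∧
    deriv (fun r' => thetaFun ℓ c (⇑φ) x y r') r
      = 2 * (Real.pi : ℂ) * Complex.I * (ℓ : ℂ) * thetaFun ℓ c (⇑φ) x y r := by
  obtain ⟨C₀, hC₀⟩ := φ.exists_one_add_sq_mul_le 0
  obtain ⟨C₁, hC₁⟩ := φ.exists_one_add_sq_mul_le 1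
  obtain ⟨C₂, hC₂⟩ := (SchwartzMap.derivCLM ℝ ℂ φ).exists_one_add_sq_mul_le 0
  obtain ⟨u₀, hu₀, h₀⟩ := exists_summable_bound_thetaTerm ℓ c (f := φ) (C := C₀)
    (fun ξ => by simpa using hC₀ ξ) y
  obtain ⟨u₁, hu₁, h₁⟩ := exists_summable_bound_thetaTerm ℓ c (f := fun ξ => (ξ : ℂ) * φ ξ)
    (C := C₁) (fun ξ => by simpa using hC₁ ξ) y
  obtain ⟨u₂, hu₂, h₂⟩ := exists_summable_bound_thetaTerm ℓ c (f := deriv φ) (C := C₂)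
    (fun ξ => by simpa using hC₂ ξ) y
  have hy : y ∈ ball y 1 := mem_ball_self one_pos
  have s₀ : Summable fun k => thetaTerm ℓ c φ k x y r :=
    .of_norm_bounded hu₀ fun k => h₀ k x r y hy
  have s₁ : Summable fun k => thetaTerm ℓ c (fun ξ => (ξ : ℂ) * φ ξ) k x y r :=
    .of_norm_bounded hu₁ fun k => h₁ k x r y hy
  have s₂ : Summable fun k => thetaTerm ℓ c (deriv φ) k x y r :=
    .of_norm_bounded hu₂ fun k => h₂ k x r y hy
  have hr : deriv (fun r' => thetaFun ℓ c φ x y r') r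
      = 2 * (Real.pi : ℂ) * Complex.I * (ℓ : ℂ) * thetaFun ℓ c φ x y r := by
    refine (hasDerivAt_tsum (hu₀.mul_left ‖2 * (Real.pi : ℂ) * Complex.I * (ℓ : ℂ)‖)
      (fun k r' => hasDerivAt_thetaTerm_r ℓ c φ k x y r') (fun k r' => ?_) s₀ r).deriv.trans
      tsum_mul_left
    rw [norm_mul]
    gcongr
    exact h₀ k x r' y hy
  have hx : deriv (fun x' => thetaFun ℓ c φ x' y r) x
      = -(4 * (Real.pi : ℂ) * Complex.I * (ℓ : ℂ)) *
          thetaFun ℓ c (fun ξ => (ξ : ℂ) * φ ξ) x y r +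
        2 * (Real.pi : ℂ) * Complex.I * (ℓ : ℂ) * y * thetaFun ℓ c φ x y r := by
    refine (hasDerivAt_tsum
      ((hu₁.mul_left ‖-(4 * (Real.pi : ℂ) * Complex.I * (ℓ : ℂ))‖).add
        (hu₀.mul_left ‖2 * (Real.pi : ℂ) * Complex.I * (ℓ : ℂ) * y‖))
      (fun k x' => hasDerivAt_thetaTerm_x ℓ c φ k x' y r) (fun k x' => ?_) s₀ x).deriv.trans
      ((s₁.hasSum.mul_left _).add (s₀.hasSum.mul_left _)).tsum_eq
    refine (norm_add_le _ _).trans ?_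
    rw [norm_mul, norm_mul _ (thetaTerm ℓ c φ k x' y r)]
    gcongr
    · exact h₁ k x' r y hy
    · exact h₀ k x' r y hy
  have hy' : deriv (fun y' => thetaFun ℓ c φ x y' r) y
      = thetaFun ℓ c (deriv φ) x y r -
        2 * (Real.pi : ℂ) * Complex.I * (ℓ : ℂ) * x * thetaFun ℓ c φ x y r := by
    refine (hasDerivAt_tsum_of_isPreconnected
      (hu₂.add (hu₀.mul_left ‖2 * (Real.pi : ℂ) * Complex.I * (ℓ : ℂ) * x‖))
      isOpen_ball (convex_ball y 1).isPreconnected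
      (fun k y' _ => hasDerivAt_thetaTerm_y ℓ c φ.differentiable k x y' r)
      (fun k y' hy' => ?_) hy s₀ hy).deriv.trans
      (s₂.hasSum.sub (s₀.hasSum.mul_left _)).tsum_eq
    refine (norm_sub_le _ _).trans ?_
    rw [norm_mul _ (thetaTerm ℓ c φ k x y' r)]
    gcongr
    · exact h₂ k x r y' hy'
    · exact h₀ k x r y' hy'
  refine ⟨?_, ?_, hr⟩
  · rw [hx, hr]
    ring
  · rw [hy', hr]
    ring
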